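/- arXiv:1211.0091 — 9 statements merged into one kernel-verified Lean document; each statement's English description precedes it below -/
import Mathlib

section
/- For every natural number n ≥ 2, the set S of constant positions, S = {p : ZMod n → ℕ | p i = p j for all i, j}, satisfies conditions (I) and (II) for the game CN(n, n−1): (I) for every p ∈ S, every legal move of CN(n, n−1) from p leads to a position not in S; (II) for every position p ∉ S there is a legal move of CN(n, n−1) from p to some position in S. Hence S is the set of losing positions of CN(n, n−1). -/
/-- A legal move of circular Nim CN(n,k): choose an index `i`; the new position `p'`
is pointwise ≤ `p`, agrees with `p` outside the arc `{i, i+1, …, i+(k-1)}`, and differs from `p`. -/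
def IsMove (n k : ℕ) (p p' : ZMod n → ℕ) : Prop :=
  ∃ i : ZMod n, (∀ j, p' j ≤ p j) ∧
    (∀ j : ZMod n, (∀ t : ℕ, t < k → j ≠ i + (t : ZMod n)) → p' j = p j) ∧
    p' ≠ p

/-- `q` is a symmetry (rotation or reflection) of the position `p`. -/
def IsSymmPos (n : ℕ) (p q : ZMod n → ℕ) : Prop :=
  ∃ l : ZMod n, (∀ j, q j = p (j + l)) ∨ (∀ j, q j = p (l - j))

/-- Condition (I): every legal move from a position in `S` leads outside of `S`. -/
def CondI (n k : ℕ) (S : Set (ZMod n → ℕ)) : Prop :=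
  ∀ p ∈ S, ∀ p', IsMove n k p p' → p' ∉ S

/-- Condition (II): from every position not in `S` there is a legal move into `S`. -/
def CondII (n k : ℕ) (S : Set (ZMod n → ℕ)) : Prop :=
  ∀ p, p ∉ S → ∃ p', IsMove n k p p' ∧ p' ∈ S

/-- The only index outside the arc of length `n - 1` starting at `i` is `i - 1`. -/
theorem outside_arc_iff (n : ℕ) (hn : 2 ≤ n) (i j : ZMod n) :
    (∀ t : ℕ, t < n - 1 → j ≠ i + (t : ZMod n)) ↔ j = i - 1 := by
  haveI : NeZero n := ⟨by omega⟩
  constructor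
  · intro h
    have hv : ((j - i).val : ZMod n) = j - i := ZMod.natCast_zmod_val _
    have hlt : (j - i).val < n := ZMod.val_lt _
    have hge : ¬ (j - i).val < n - 1 := fun hl => h _ hl (by rw [hv]; ring)
    have heq : (j - i).val + 1 = n := by omega
    have h0 : (((j - i).val + 1 : ℕ) : ZMod n) = 0 := by rw [heq]; simp
    push_cast at h0
    rw [hv] at h0
    linear_combination h0
  · rintro rfl t ht he
    have h0 : ((t + 1 : ℕ) : ZMod n) = 0 := by
      push_cast
      linear_combination -he
    rw [ZMod.natCast_eq_zero_iff] at h0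
    have := Nat.le_of_dvd (by omega) h0
    omega

theorem CN_n_nsub1_losing (n : ℕ) (hn : 2 ≤ n) :
    CondI n (n - 1) {p : ZMod n → ℕ | ∀ i j, p i = p j} ∧
    CondII n (n - 1) {p : ZMod n → ℕ | ∀ i j, p i = p j} := by
  haveI : NeZero n := ⟨by omega⟩
  constructor
  · rintro p hp p' ⟨i, -, hout, hne⟩ hp'
    have h := hout (i - 1) ((outside_arc_iff n hn i _).2 rfl)
    exact hne (funext fun j => by rw [hp' j (i - 1), h, hp (i - 1) j])
  · intro p hp
    obtain ⟨m, hm⟩ := Finite.exists_min p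
    refine ⟨fun _ => p m, ⟨m + 1, hm, ?_, ?_⟩, fun _ _ => rfl⟩
    · intro j hj
      have h := (outside_arc_iff n hn _ _).1 hj
      rw [h, add_sub_cancel_right]
    · intro he
      exact hp fun a b => by rw [← congrFun he a, ← congrFun he b]
end

section
/- The set S = {p : ZMod 4 → ℕ | p 0 = p 2 and p 1 = p 3} satisfies conditions (I) and (II) for the game CN(4,2): (I) for every p ∈ S, every legal move of CN(4,2) from p leads to a position not in S; (II) for every position p ∉ S there is a legal move of CN(4,2) from p to some position in S. Hence S is the set of losing positions of CN(4,2). -/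
theorem CN_4_2_losing :
    CondI 4 2 {p : ZMod 4 → ℕ | p 0 = p 2 ∧ p 1 = p 3} ∧
    CondII 4 2 {p : ZMod 4 → ℕ | p 0 = p 2 ∧ p 1 = p 3} := by
  have key : ∀ i : ZMod 4, ∀ j : ZMod 4, j ≠ i → j ≠ i + 1 →
      ∀ t : ℕ, t < 2 → j ≠ i + (t : ZMod 4) := by
    intro i j h0 h1 t ht
    interval_cases t
    · simpa using h0
    · simpa using h1
  have cases4 : ∀ i : ZMod 4, i = 0 ∨ i = 1 ∨ i = 2 ∨ i = 3 := by decide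
  have d2 : ∀ i : ZMod 4, i + 2 ≠ i ∧ i + 2 ≠ i + 1 := by decide
  have d3 : ∀ i : ZMod 4, i + 3 ≠ i ∧ i + 3 ≠ i + 1 := by decide
  constructor
  · rintro p ⟨h02, h13⟩ p' ⟨i, -, hout, hne⟩ ⟨h02', h13'⟩
    apply hne
    have a := hout (i + 2) (key i _ (d2 i).1 (d2 i).2)
    have b := hout (i + 3) (key i _ (d3 i).1 (d3 i).2)
    have hp : ∀ j, p (j + 2) = p j := by
      intro j
      rcases cases4 j with rfl | rfl | rfl | rfl
      exacts [h02.symm, h13.symm, h02, h13]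
    have hp' : ∀ j, p' (j + 2) = p' j := by
      intro j
      rcases cases4 j with rfl | rfl | rfl | rfl
      exacts [h02'.symm, h13'.symm, h02', h13']
    have e : i + 3 = (i + 1) + 2 := by ring
    rw [e] at b
    have a' : p' i = p i := by rw [← hp', a, hp]
    have b' : p' (i + 1) = p (i + 1) := by rw [← hp', b, hp]
    have cov : ∀ i j : ZMod 4, j = i ∨ j = i + 1 ∨ j = i + 2 ∨ j = i + 1 + 2 := by decide
    funext j
    rcases cov i j with rfl | rfl | rfl | rfl <;> assumption
  · intro p hp
    have mem : (fun j => min (p j) (p (j + 2))) ∈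
        {p : ZMod 4 → ℕ | p 0 = p 2 ∧ p 1 = p 3} := by
      exact ⟨min_comm _ _, min_comm _ _⟩
    have hne : (fun j => min (p j) (p (j + 2))) ≠ p := by
      intro h
      rw [h] at mem
      exact hp mem
    -- the arc covers the larger stack of each opposite pair
    have hi : ∃ i : ZMod 4, p (i + 2) ≤ p (i + 2 + 2) ∧ p (i + 3) ≤ p (i + 3 + 2) := by
      rcases le_total (p 0) (p 2) with h | h <;> rcases le_total (p 1) (p 3) with h' | h'
      · exact ⟨2, h, h'⟩
      · exact ⟨1, h', h⟩
      · exact ⟨3, h', h⟩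
      · exact ⟨0, h, h'⟩
    obtain ⟨i, h2, h3⟩ := hi
    refine ⟨_, ⟨i, fun j => min_le_left _ _, ?_, hne⟩, mem⟩
    intro j hj
    have n0 : j ≠ i := by simpa using hj 0 (by norm_num)
    have n1 : j ≠ i + 1 := by simpa using hj 1 (by norm_num)
    have cov : ∀ i j : ZMod 4, j ≠ i → j ≠ i + 1 → j = i + 2 ∨ j = i + 3 := by decide
    rcases cov i j n0 n1 with rfl | rfl
    · exact min_eq_left h2
    · exact min_eq_left h3
end

section
/- Let S be the set of positions p : ZMod 5 → ℕ such that some symmetry q of p satisfies q 1 = q 4, q 0 + q 1 = q 2 + q 3, and q 0 ≥ q j for all j (i.e., up to rotation and reflection p has the form (a,b,c,d,b) with a + b = c + d and a maximal). Then S satisfies conditions (I) and (II) for the game CN(5,2): (I) for every p ∈ S, every legal move of CN(5,2) from p leads to a position not in S; (II) for every position p ∉ S there is a legal move of CN(5,2) from p to some position in S. Hence S is the set of losing positions of CN(5,2). -/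
/-- The losing form with the maximum at index `l`. -/
def LForm (p : ZMod 5 → ℕ) (l : ZMod 5) : Prop :=
  p (l + 1) = p (l + 4) ∧ p l + p (l + 1) = p (l + 2) + p (l + 3) ∧
    p (l + 1) ≤ p l ∧ p (l + 2) ≤ p l ∧ p (l + 3) ≤ p l ∧ p (l + 4) ≤ p l

theorem forall_zmod5 {P : ZMod 5 → Prop} :
    (∀ j, P j) ↔ P 0 ∧ P 1 ∧ P 2 ∧ P 3 ∧ P 4 := by
  constructor
  · intro h
    exact ⟨h _, h _, h _, h _, h _⟩
  · rintro ⟨h0, h1, h2, h3, h4⟩ j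
    have : ∀ j : ZMod 5, j = 0 ∨ j = 1 ∨ j = 2 ∨ j = 3 ∨ j = 4 := by decide
    rcases this j with h | h | h | h | h <;> subst h <;> assumption

theorem exists_shift (l : ZMod 5) {P : ZMod 5 → Prop} :
    (∀ j, P j) ↔ P l ∧ P (l + 1) ∧ P (l + 2) ∧ P (l + 3) ∧ P (l + 4) := by
  constructor
  · intro h
    exact ⟨h _, h _, h _, h _, h _⟩
  · rintro ⟨h0, h1, h2, h3, h4⟩ j
    have : ∀ j l : ZMod 5, j = l ∨ j = l + 1 ∨ j = l + 2 ∨ j = l + 3 ∨ j = l + 4 := by decide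
    rcases this j l with h | h | h | h | h <;> rw [h] <;> assumption

theorem mem_iff (p : ZMod 5 → ℕ) :
    (∃ q : ZMod 5 → ℕ, IsSymmPos 5 p q ∧
      q 1 = q 4 ∧ q 0 + q 1 = q 2 + q 3 ∧ ∀ j, q j ≤ q 0) ↔ ∃ l, LForm p l := by
  constructor
  · rintro ⟨q, ⟨l, h | h⟩, h1, h2, h3⟩
    · refine ⟨l, ?_⟩
      rw [forall_zmod5] at h3
      simp only [h, zero_add] at h1 h2 h3
      simp only [LForm, add_comm l]
      omega
    · refine ⟨l, ?_⟩
      rw [forall_zmod5] at h3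
      have e1 : l - 1 = l + 4 := (by decide : ∀ l : ZMod 5, l - 1 = l + 4) l
      have e2 : l - 2 = l + 3 := (by decide : ∀ l : ZMod 5, l - 2 = l + 3) l
      have e3 : l - 3 = l + 2 := (by decide : ∀ l : ZMod 5, l - 3 = l + 2) l
      have e4 : l - 4 = l + 1 := (by decide : ∀ l : ZMod 5, l - 4 = l + 1) l
      simp only [h, sub_zero, e1, e2, e3, e4] at h1 h2 h3
      simp only [LForm]
      omega
  · rintro ⟨l, h⟩
    refine ⟨fun j => p (j + l), ⟨l, Or.inl fun _ => rfl⟩, ?_⟩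
    rw [forall_zmod5]
    simp only [LForm, add_comm l] at h
    simp only [zero_add]
    omega

theorem move_iff (p p' : ZMod 5 → ℕ) :
    IsMove 5 2 p p' ↔ ∃ i, p' i ≤ p i ∧ p' (i + 1) ≤ p (i + 1) ∧ p' (i + 2) = p (i + 2) ∧
      p' (i + 3) = p (i + 3) ∧ p' (i + 4) = p (i + 4) ∧ p' ≠ p := by
  constructor
  · rintro ⟨i, h1, h2, h3⟩
    refine ⟨i, h1 _, h1 _, h2 _ ?_, h2 _ ?_, h2 _ ?_, h3⟩ <;>
    · intro t ht
      clear h2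
      interval_cases t <;> revert i <;> decide
  · rintro ⟨i, h0, h1, h2, h3, h4, h5⟩
    refine ⟨i, ?_, ?_, h5⟩
    · rw [exists_shift i]
      omega
    · rw [exists_shift i]
      refine ⟨fun h => ?_, fun h => ?_, fun _ => h2, fun _ => h3, fun _ => h4⟩
      · exact absurd (by simp) (h 0 (by norm_num))
      · exact absurd (by simp) (h 1 (by norm_num))

theorem shift_cases (l m : ZMod 5) :
    m = l ∨ m = l + 1 ∨ m = l + 2 ∨ m = l + 3 ∨ m = l + 4 := by
  revert l m; decide

theorem add_red (l : ZMod 5) :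
    l + 1 + 1 = l + 2 ∧ l + 1 + 2 = l + 3 ∧ l + 1 + 3 = l + 4 ∧ l + 1 + 4 = l ∧
    l + 2 + 1 = l + 3 ∧ l + 2 + 2 = l + 4 ∧ l + 2 + 3 = l ∧ l + 2 + 4 = l + 1 ∧
    l + 3 + 1 = l + 4 ∧ l + 3 + 2 = l ∧ l + 3 + 3 = l + 1 ∧ l + 3 + 4 = l + 2 ∧
    l + 4 + 1 = l ∧ l + 4 + 2 = l + 1 ∧ l + 4 + 3 = l + 2 ∧ l + 4 + 4 = l + 3 := by
  revert l; decide

theorem condI_aux (p p' : ZMod 5 → ℕ) (l l' : ZMod 5) (h : LForm p l) (h' : LForm p' l')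
    (hm : IsMove 5 2 p p') : False := by
  rw [move_iff] at hm
  obtain ⟨i, m0, m1, m2, m3, m4, hne⟩ := hm
  have hne' : ¬ (p' l = p l ∧ p' (l + 1) = p (l + 1) ∧ p' (l + 2) = p (l + 2) ∧
      p' (l + 3) = p (l + 3) ∧ p' (l + 4) = p (l + 4)) := by
    intro hh
    exact hne (funext ((exists_shift l).2 hh))
  clear hne
  have e := add_red l
  unfold LForm at h h'
  rcases shift_cases l l' with hl | hl | hl | hl | hl <;>
  rcases shift_cases l i with hi | hi | hi | hi | hi <;>
  simp only [hl, hi, e] at h' m0 m1 m2 m3 m4 <;> clear e <;> omega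

/-- The position with prescribed values along the circle, read from `m`. -/
theorem exists_pos (m : ZMod 5) (x0 x1 x2 x3 x4 : ℕ) : ∃ p : ZMod 5 → ℕ,
    p m = x0 ∧ p (m + 1) = x1 ∧ p (m + 2) = x2 ∧ p (m + 3) = x3 ∧ p (m + 4) = x4 := by
  refine ⟨fun j => if j = m then x0 else if j = m + 1 then x1 else if j = m + 2 then x2
    else if j = m + 3 then x3 else x4, ?_⟩
  have h : m + 1 ≠ m ∧ m + 2 ≠ m ∧ m + 3 ≠ m ∧ m + 4 ≠ m ∧ m + 2 ≠ m + 1 ∧ m + 3 ≠ m + 1 ∧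
    m + 4 ≠ m + 1 ∧ m + 3 ≠ m + 2 ∧ m + 4 ≠ m + 2 ∧ m + 4 ≠ m + 3 := by revert m; decide
  simp only [h, if_true, if_false, and_self]

theorem condII_aux (p : ZMod 5 → ℕ) (hp : ¬ ∃ l, LForm p l) :
    ∃ p', IsMove 5 2 p p' ∧ ∃ l, LForm p' l := by
  suffices h : ∃ p', (∃ i, p' i ≤ p i ∧ p' (i + 1) ≤ p (i + 1) ∧ p' (i + 2) = p (i + 2) ∧
      p' (i + 3) = p (i + 3) ∧ p' (i + 4) = p (i + 4)) ∧ ∃ l, LForm p' l by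
    obtain ⟨p', ⟨i, h0, h1, h2, h3, h4⟩, hl⟩ := h
    refine ⟨p', (move_iff _ _).2 ⟨i, h0, h1, h2, h3, h4, ?_⟩, hl⟩
    rintro rfl
    exact hp hl
  obtain ⟨m, hm⟩ := Finite.exists_min p
  have a1 := hm (m + 1)
  have a2 := hm (m + 2)
  have a3 := hm (m + 3)
  have a4 := hm (m + 4)
  have e := add_red m
  unfold LForm
  rcases le_total (p (m + 4)) (p (m + 1)) with h | h
  · rcases le_total (p (m + 3) + p (m + 4)) (p (m + 1) + p m) with h' | h'
    · obtain ⟨q, hq⟩ := exists_pos m (p m) (p (m + 3) + p (m + 4) - p m) (p m)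
        (p (m + 3)) (p (m + 4))
      refine ⟨q, ⟨m + 1, ?_⟩, m + 1, ?_⟩ <;> simp only [e] <;> omega
    · obtain ⟨q, hq⟩ := exists_pos m (p m) (p (m + 1)) (p m)
        (p (m + 1) + p m - p (m + 4)) (p (m + 4))
      refine ⟨q, ⟨m + 2, ?_⟩, m + 1, ?_⟩ <;> simp only [e] <;> omega
  · rcases le_total (p (m + 1) + p (m + 2)) (p (m + 4) + p m) with h' | h'
    · obtain ⟨q, hq⟩ := exists_pos m (p m) (p (m + 1)) (p (m + 2)) (p m)
        (p (m + 1) + p (m + 2) - p m)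
      refine ⟨q, ⟨m + 3, ?_⟩, m + 4, ?_⟩ <;> simp only [e] <;> omega
    · obtain ⟨q, hq⟩ := exists_pos m (p m) (p (m + 1)) (p (m + 4) + p m - p (m + 1))
        (p m) (p (m + 4))
      refine ⟨q, ⟨m + 2, ?_⟩, m + 4, ?_⟩ <;> simp only [e] <;> omega

theorem CN_5_2_losing :
    CondI 5 2 {p : ZMod 5 → ℕ | ∃ q : ZMod 5 → ℕ, IsSymmPos 5 p q ∧
      q 1 = q 4 ∧ q 0 + q 1 = q 2 + q 3 ∧ ∀ j, q j ≤ q 0} ∧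
    CondII 5 2 {p : ZMod 5 → ℕ | ∃ q : ZMod 5 → ℕ, IsSymmPos 5 p q ∧
      q 1 = q 4 ∧ q 0 + q 1 = q 2 + q 3 ∧ ∀ j, q j ≤ q 0} := by
  simp only [mem_iff]
  constructor
  · rintro p ⟨l, hl⟩ p' hm ⟨l', hl'⟩
    exact condI_aux p p' l l' hl hl' hm
  · intro p hp
    exact condII_aux p hp
end

section
/- Let S be the set of positions p : ZMod 5 → ℕ such that some symmetry q of p satisfies q 0 = 0, q 1 = q 4, and q 1 = q 2 + q 3 (i.e., up to rotation and reflection p has the form (0,b,c,d,b) with b = c + d). Then S satisfies conditions (I) and (II) for the game CN(5,3): (I) for every p ∈ S, every legal move of CN(5,3) from p leads to a position not in S; (II) for every position p ∉ S there is a legal move of CN(5,3) from p to some position in S. Hence S is the set of losing positions of CN(5,3). -/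
theorem zmod5_cases (u : ZMod 5) : u = 0 ∨ u = 1 ∨ u = 2 ∨ u = 3 ∨ u = 4 := by
  revert u; decide

theorem zmod5_cases_shift (l j : ZMod 5) :
    j = l ∨ j = l + 1 ∨ j = l + 2 ∨ j = l + 3 ∨ j = l + 4 := by
  revert l j; decide

theorem zmod5_add : ((1 : ZMod 5) + 1 = 2 ∧ (1 : ZMod 5) + 2 = 3 ∧ (1 : ZMod 5) + 3 = 4 ∧
    (1 : ZMod 5) + 4 = 0 ∧ (2 : ZMod 5) + 1 = 3 ∧ (2 : ZMod 5) + 2 = 4 ∧ (2 : ZMod 5) + 3 = 0 ∧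
    (2 : ZMod 5) + 4 = 1) ∧ (3 : ZMod 5) + 1 = 4 ∧ (3 : ZMod 5) + 2 = 0 ∧ (3 : ZMod 5) + 3 = 1 ∧
    (3 : ZMod 5) + 4 = 2 ∧ (4 : ZMod 5) + 1 = 0 ∧ (4 : ZMod 5) + 2 = 1 ∧ (4 : ZMod 5) + 3 = 2 ∧
    (4 : ZMod 5) + 4 = 3 := by
  decide

/-- Losing shape with the empty stack at index `l`. -/
def LoseAt (p : ZMod 5 → ℕ) (l : ZMod 5) : Prop :=
  p l = 0 ∧ p (l + 1) = p (l + 4) ∧ p (l + 1) = p (l + 2) + p (l + 3)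

theorem mem_iff_loseAt (p : ZMod 5 → ℕ) :
    (∃ q : ZMod 5 → ℕ, IsSymmPos 5 p q ∧ q 0 = 0 ∧ q 1 = q 4 ∧ q 1 = q 2 + q 3) ↔
      ∃ l, LoseAt p l := by
  constructor
  · rintro ⟨q, ⟨l, h | h⟩, h0, h1, h2⟩
    · refine ⟨l, ?_⟩
      simp only [h] at h0 h1 h2
      simp only [LoseAt, add_comm l]
      rw [zero_add] at h0
      exact ⟨h0, h1, h2⟩
    · refine ⟨l, ?_⟩
      simp only [h] at h0 h1 h2
      have e1 : l - 1 = l + 4 := by rw [sub_eq_add_neg]; rfl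
      have e2 : l - 2 = l + 3 := by rw [sub_eq_add_neg]; rfl
      have e3 : l - 3 = l + 2 := by rw [sub_eq_add_neg]; rfl
      have e4 : l - 4 = l + 1 := by rw [sub_eq_add_neg]; rfl
      rw [e1, e4] at h1
      rw [e1, e2, e3] at h2
      rw [sub_zero] at h0
      refine ⟨h0, h1.symm, ?_⟩
      omega
  · rintro ⟨l, h0, h1, h2⟩
    refine ⟨fun j => p (j + l), ⟨l, Or.inl fun j => rfl⟩, ?_⟩
    simp only [add_comm _ l, add_zero]
    exact ⟨h0, h1, h2⟩

theorem arc_compl (i j : ZMod 5) (h : ∀ t : ℕ, t < 3 → j ≠ i + (t : ZMod 5)) :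
    j = i + 3 ∨ j = i + 4 := by
  have h0 := h 0 (by norm_num)
  have h1 := h 1 (by norm_num)
  have h2 := h 2 (by norm_num)
  push_cast at h0 h1 h2
  clear h
  revert i j
  decide

theorem arc_compl' (i j : ZMod 5) (h : j = i + 3 ∨ j = i + 4) :
    ∀ t : ℕ, t < 3 → j ≠ i + (t : ZMod 5) := by
  intro t ht
  interval_cases t <;> push_cast <;> revert i j <;> decide

theorem forall_shift {P : ZMod 5 → Prop} (l : ZMod 5) :
    (∀ j, P j) ↔ P l ∧ P (l + 1) ∧ P (l + 2) ∧ P (l + 3) ∧ P (l + 4) := by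
  constructor
  · intro h
    exact ⟨h _, h _, h _, h _, h _⟩
  · rintro ⟨h0, h1, h2, h3, h4⟩ j
    rcases zmod5_cases_shift l j with h | h | h | h | h <;> rw [h] <;> assumption

/-- Prescribe the five heights starting from index `l`. -/
theorem exists_pos_s3 (l : ZMod 5) (a b c d e : ℕ) : ∃ q : ZMod 5 → ℕ,
    q l = a ∧ q (l + 1) = b ∧ q (l + 2) = c ∧ q (l + 3) = d ∧ q (l + 4) = e := by
  refine ⟨fun j => (![a, b, c, d, e] : Fin 5 → ℕ) (j - l : ZMod 5), ?_⟩
  simp only [sub_self, add_sub_cancel_left]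
  exact ⟨rfl, rfl, rfl, rfl, rfl⟩

theorem condI_aux_s3 (p p' : ZMod 5 → ℕ) (l m i : ZMod 5) (hp : LoseAt p l) (hp' : LoseAt p' m)
    (hle : ∀ j, p' j ≤ p j) (h3 : p' (i + 3) = p (i + 3)) (h4 : p' (i + 4) = p (i + 4)) :
    p' = p := by
  rw [funext_iff, forall_shift l]
  rw [forall_shift l] at hle
  obtain ⟨a0, a1, a2⟩ := hp
  obtain ⟨b0, b1, b2⟩ := hp'
  obtain ⟨u, rfl⟩ : ∃ u, m = l + u := ⟨m - l, by ring⟩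
  obtain ⟨v, rfl⟩ : ∃ v, i = l + v := ⟨i - l, by ring⟩
  have hu : u = 0 ∨ u = 1 ∨ u = 2 ∨ u = 3 ∨ u = 4 := zmod5_cases u
  have hv : v = 0 ∨ v = 1 ∨ v = 2 ∨ v = 3 ∨ v = 4 := zmod5_cases v
  rcases hu with rfl | rfl | rfl | rfl | rfl <;> rcases hv with rfl | rfl | rfl | rfl | rfl <;>
    simp only [add_assoc, zmod5_add, add_zero, zero_add] at * <;> omega

/-- Conditions under which one move creates the losing shape with empty stack at index `l`. -/
def Reach (p : ZMod 5 → ℕ) (l : ZMod 5) : Prop :=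
  (p (l + 2) + p (l + 3) ≤ p (l + 1) ∧ p (l + 2) + p (l + 3) ≤ p (l + 4)) ∨
  (p (l + 2) ≤ p (l + 1) ∧ p (l + 1) ≤ p (l + 2) + p (l + 3) ∧ p (l + 1) ≤ p (l + 4)) ∨
  (p (l + 3) ≤ p (l + 4) ∧ p (l + 4) ≤ p (l + 2) + p (l + 3) ∧ p (l + 4) ≤ p (l + 1))

theorem exists_reach (p : ZMod 5 → ℕ) : ∃ l, Reach p l := by
  obtain ⟨m, hm⟩ := Finite.exists_min p
  obtain ⟨l, rfl⟩ : ∃ l, m = l + 2 := ⟨m - 2, by ring⟩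
  have h : Reach p l ∨ Reach p (l + 4) ∨ Reach p (l + 2) := by
    rw [forall_shift l] at hm
    simp only [Reach, add_assoc, zmod5_add, add_zero]
    obtain ⟨h0, h1, -, h3, h4⟩ := hm
    generalize p l = x0 at *
    generalize p (l + 1) = x1 at *
    generalize p (l + 2) = x2 at *
    generalize p (l + 3) = x3 at *
    generalize p (l + 4) = x4 at *
    omega
  rcases h with h | h | h <;> exact ⟨_, h⟩

theorem reach_move (p : ZMod 5 → ℕ) (l : ZMod 5) (h : Reach p l) :
    ∃ p' i, (∀ j, p' j ≤ p j) ∧ p' (i + 3) = p (i + 3) ∧ p' (i + 4) = p (i + 4) ∧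
      LoseAt p' l := by
  rcases h with h | h | h
  · obtain ⟨q, h0, h1, h2, h3, h4⟩ := exists_pos_s3 l 0 (p (l + 2) + p (l + 3)) (p (l + 2))
      (p (l + 3)) (p (l + 2) + p (l + 3))
    have e3 : l + 4 + 3 = l + 2 := by rw [add_assoc]; rfl
    have e4 : l + 4 + 4 = l + 3 := by rw [add_assoc]; rfl
    refine ⟨q, l + 4, (forall_shift l).2 ?_, ?_, ?_, ?_, ?_, ?_⟩ <;>
      simp only [e3, e4, h0, h1, h2, h3, h4] <;> omega
  · obtain ⟨q, h0, h1, h2, h3, h4⟩ := exists_pos_s3 l 0 (p (l + 1)) (p (l + 2))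
      (p (l + 1) - p (l + 2)) (p (l + 1))
    have e3 : l + 3 + 3 = l + 1 := by rw [add_assoc]; rfl
    have e4 : l + 3 + 4 = l + 2 := by rw [add_assoc]; rfl
    refine ⟨q, l + 3, (forall_shift l).2 ?_, ?_, ?_, ?_, ?_, ?_⟩ <;>
      simp only [e3, e4, h0, h1, h2, h3, h4] <;> omega
  · obtain ⟨q, h0, h1, h2, h3, h4⟩ := exists_pos_s3 l 0 (p (l + 4)) (p (l + 4) - p (l + 3))
      (p (l + 3)) (p (l + 4))
    refine ⟨q, l, (forall_shift l).2 ?_, ?_, ?_, ?_, ?_, ?_⟩ <;>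
      simp only [h0, h1, h2, h3, h4] <;> omega

theorem CN_5_3_losing :
    CondI 5 3 {p : ZMod 5 → ℕ | ∃ q : ZMod 5 → ℕ, IsSymmPos 5 p q ∧
      q 0 = 0 ∧ q 1 = q 4 ∧ q 1 = q 2 + q 3} ∧
    CondII 5 3 {p : ZMod 5 → ℕ | ∃ q : ZMod 5 → ℕ, IsSymmPos 5 p q ∧
      q 0 = 0 ∧ q 1 = q 4 ∧ q 1 = q 2 + q 3} := by
  simp only [mem_iff_loseAt]
  constructor
  · rintro p ⟨l, hl⟩ p' ⟨i, hle, heq, hne⟩ ⟨m, hm⟩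
    exact hne (condI_aux_s3 p p' l m i hl hm hle
      (heq _ (arc_compl' _ _ (Or.inl rfl))) (heq _ (arc_compl' _ _ (Or.inr rfl))))
  · intro p hp
    obtain ⟨l, hl⟩ := exists_reach p
    obtain ⟨p', i, hle, h3, h4, hL⟩ := reach_move p l hl
    refine ⟨p', ⟨i, hle, ?_, ?_⟩, l, hL⟩
    · intro j hj
      rcases arc_compl i j hj with rfl | rfl
      · exact h3
      · exact h4
    · rintro rfl
      exact hp ⟨l, hL⟩
end

section
/- The set S = {p : ZMod 6 → ℕ | p 0 + p 1 = p 3 + p 4 and p 1 + p 2 = p 4 + p 5} (two pairs of diagonally opposite adjacent stacks have equal sums) satisfies conditions (I) and (II) for the game CN(6,3): (I) for every p ∈ S, every legal move of CN(6,3) from p leads to a position not in S; (II) for every position p ∉ S there is a legal move of CN(6,3) from p to some position in S. Hence S is the set of losing positions of CN(6,3). -/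
/-- Three opposite pairs `(E, O)` sorted by the difference `E - O`, not all equal: the differences can be
equalised by lowering `O₁`, `E₃` and one of `E₂`, `O₂`. -/
lemma core (E1 O1 E2 O2 E3 O3 : ℕ) (h12 : E1 + O2 ≤ E2 + O1) (h23 : E2 + O3 ≤ E3 + O2) :
    ∃ o1 e2 o2 e3 : ℕ, o1 ≤ O1 ∧ e2 ≤ E2 ∧ o2 ≤ O2 ∧ e3 ≤ E3 ∧ (e2 = E2 ∨ o2 = O2) ∧
      E1 + o2 = e2 + o1 ∧ e2 + O3 = e3 + o2 := by
  by_cases h : O2 ≤ E2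
  · by_cases h' : E2 ≤ E1 + O2
    · exact ⟨E1 + O2 - E2, E2, O2, E2 + O3 - O2, by omega, by omega, by omega, by omega,
        by omega, by omega, by omega⟩
    · exact ⟨0, E1 + O2, O2, E1 + O3, by omega, by omega, by omega, by omega,
        by omega, by omega, by omega⟩
  · by_cases h' : O2 ≤ E2 + O3
    · exact ⟨E1 + O2 - E2, E2, O2, E2 + O3 - O2, by omega, by omega, by omega, by omega,
        by omega, by omega, by omega⟩
    · exact ⟨E1 + O3, E2, E2 + O3, 0, by omega, by omega, by omega, by omega,
        by omega, by omega, by omega⟩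

/-- Build a move of CN(6,3) into a given six-tuple. -/
lemma mkMove (p : ZMod 6 → ℕ) (b0 b1 b2 b3 b4 b5 : ℕ)
    (hp : ¬ (p 0 + p 1 = p 3 + p 4 ∧ p 1 + p 2 = p 4 + p 5))
    (hb : b0 + b1 = b3 + b4 ∧ b1 + b2 = b4 + b5)
    (h0 : b0 ≤ p 0) (h1 : b1 ≤ p 1) (h2 : b2 ≤ p 2) (h3 : b3 ≤ p 3) (h4 : b4 ≤ p 4)
    (h5 : b5 ≤ p 5)
    (h : (b3 = p 3 ∧ b4 = p 4 ∧ b5 = p 5) ∨ (b4 = p 4 ∧ b5 = p 5 ∧ b0 = p 0) ∨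
      (b5 = p 5 ∧ b0 = p 0 ∧ b1 = p 1) ∨ (b0 = p 0 ∧ b1 = p 1 ∧ b2 = p 2) ∨
      (b1 = p 1 ∧ b2 = p 2 ∧ b3 = p 3) ∨ (b2 = p 2 ∧ b3 = p 3 ∧ b4 = p 4)) :
    ∃ p', IsMove 6 3 p p' ∧ (p' 0 + p' 1 = p' 3 + p' 4 ∧ p' 1 + p' 2 = p' 4 + p' 5) := by
  let q : ZMod 6 → ℕ := (![b0, b1, b2, b3, b4, b5] : Fin 6 → ℕ)
  have hq : q 0 + q 1 = q 3 + q 4 ∧ q 1 + q 2 = q 4 + q 5 := hb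
  have hle : ∀ j, q j ≤ p j := by
    intro j
    fin_cases j
    exacts [h0, h1, h2, h3, h4, h5]
  have hne : q ≠ p := fun e => hp (e ▸ hq)
  have key : ∀ i : ZMod 6, q (i + 3) = p (i + 3) → q (i + 4) = p (i + 4) →
      q (i + 5) = p (i + 5) → IsMove 6 3 p q := by
    intro i a b c
    refine ⟨i, hle, fun j hj => ?_, hne⟩
    have n0 := hj 0 (by norm_num)
    have n1 := hj 1 (by norm_num)
    have n2 := hj 2 (by norm_num)
    have hd : ∀ i j : ZMod 6, j ≠ i + ((0 : ℕ) : ZMod 6) → j ≠ i + ((1 : ℕ) : ZMod 6) →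
      j ≠ i + ((2 : ℕ) : ZMod 6) → j = i + 3 ∨ j = i + 4 ∨ j = i + 5 := by decide
    rcases hd i j n0 n1 n2 with r | r | r <;> rw [r] <;> assumption
  refine ⟨q, ?_, hq⟩
  rcases h with ⟨a, b, c⟩ | ⟨a, b, c⟩ | ⟨a, b, c⟩ | ⟨a, b, c⟩ | ⟨a, b, c⟩ | ⟨a, b, c⟩
  · exact key 0 a b c
  · exact key 1 a b c
  · exact key 2 a b c
  · exact key 3 a b c
  · exact key 4 a b c
  · exact key 5 a b c

theorem CN_6_3_losing :
    CondI 6 3 {p : ZMod 6 → ℕ | p 0 + p 1 = p 3 + p 4 ∧ p 1 + p 2 = p 4 + p 5} ∧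
    CondII 6 3 {p : ZMod 6 → ℕ | p 0 + p 1 = p 3 + p 4 ∧ p 1 + p 2 = p 4 + p 5} := by
  constructor
  · rintro p ⟨hp1, hp2⟩ p' ⟨i, hle, heq, hne⟩ ⟨hq1, hq2⟩
    apply hne
    have hd : ∀ i : ZMod 6, ∀ s : ZMod 6, s = 3 ∨ s = 4 ∨ s = 5 →
        ∀ t : ℕ, t < 3 → i + s ≠ i + (t : ZMod 6) := by decide
    have e3 := heq (i + 3) (hd i 3 (by simp))
    have e4 := heq (i + 4) (hd i 4 (by simp))
    have e5 := heq (i + 5) (hd i 5 (by simp))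
    have l0 := hle 0
    have l1 := hle 1
    have l2 := hle 2
    have l3 := hle 3
    have l4 := hle 4
    have l5 := hle 5
    have all : p' 0 = p 0 ∧ p' 1 = p 1 ∧ p' 2 = p 2 ∧ p' 3 = p 3 ∧ p' 4 = p 4 ∧ p' 5 = p 5 := by
      have hi : ∀ i : ZMod 6, i = 0 ∨ i = 1 ∨ i = 2 ∨ i = 3 ∨ i = 4 ∨ i = 5 := by decide
      rcases hi i with r | r | r | r | r | r <;> subst r
      · change p' 3 = p 3 at e3; change p' 4 = p 4 at e4; change p' 5 = p 5 at e5; omega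
      · change p' 4 = p 4 at e3; change p' 5 = p 5 at e4; change p' 0 = p 0 at e5; omega
      · change p' 5 = p 5 at e3; change p' 0 = p 0 at e4; change p' 1 = p 1 at e5; omega
      · change p' 0 = p 0 at e3; change p' 1 = p 1 at e4; change p' 2 = p 2 at e5; omega
      · change p' 1 = p 1 at e3; change p' 2 = p 2 at e4; change p' 3 = p 3 at e5; omega
      · change p' 2 = p 2 at e3; change p' 3 = p 3 at e4; change p' 4 = p 4 at e5; omega
    obtain ⟨a0, a1, a2, a3, a4, a5⟩ := all
    funext j
    fin_cases j
    exacts [a0, a1, a2, a3, a4, a5]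
  · intro p hp
    change ¬ (p 0 + p 1 = p 3 + p 4 ∧ p 1 + p 2 = p 4 + p 5) at hp
    change ∃ p', IsMove 6 3 p p' ∧ (p' 0 + p' 1 = p' 3 + p' 4 ∧ p' 1 + p' 2 = p' 4 + p' 5)
    have hcases : (p 0 + p 5 ≤ p 2 + p 3 ∧ p 2 + p 1 ≤ p 4 + p 5) ∨
      (p 0 + p 1 ≤ p 4 + p 3 ∧ p 4 + p 5 ≤ p 2 + p 1) ∨
      (p 2 + p 3 ≤ p 0 + p 5 ∧ p 0 + p 1 ≤ p 4 + p 3) ∨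
      (p 2 + p 1 ≤ p 4 + p 5 ∧ p 4 + p 3 ≤ p 0 + p 1) ∨
      (p 4 + p 3 ≤ p 0 + p 1 ∧ p 0 + p 5 ≤ p 2 + p 3) ∨
      (p 4 + p 5 ≤ p 2 + p 1 ∧ p 2 + p 3 ≤ p 0 + p 5) := by omega
    rcases hcases with ⟨u, v⟩ | ⟨u, v⟩ | ⟨u, v⟩ | ⟨u, v⟩ | ⟨u, v⟩ | ⟨u, v⟩
    · obtain ⟨o1, e2, o2, e3, c1, c2, c3, c4, c5, c6, c7⟩ :=
        core (p 0) (p 3) (p 2) (p 5) (p 4) (p 1) u v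
      exact mkMove p (p 0) (p 1) e2 o1 e3 o2 hp (by omega) (by omega) (by omega) (by omega)
        (by omega) (by omega) (by omega) (by omega)
    · obtain ⟨o1, e2, o2, e3, c1, c2, c3, c4, c5, c6, c7⟩ :=
        core (p 0) (p 3) (p 4) (p 1) (p 2) (p 5) u v
      exact mkMove p (p 0) o2 e3 o1 e2 (p 5) hp (by omega) (by omega) (by omega) (by omega)
        (by omega) (by omega) (by omega) (by omega)
    · obtain ⟨o1, e2, o2, e3, c1, c2, c3, c4, c5, c6, c7⟩ :=
        core (p 2) (p 5) (p 0) (p 3) (p 4) (p 1) u v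
      exact mkMove p e2 (p 1) (p 2) o2 e3 o1 hp (by omega) (by omega) (by omega) (by omega)
        (by omega) (by omega) (by omega) (by omega)
    · obtain ⟨o1, e2, o2, e3, c1, c2, c3, c4, c5, c6, c7⟩ :=
        core (p 2) (p 5) (p 4) (p 1) (p 0) (p 3) u v
      exact mkMove p e3 o2 (p 2) (p 3) e2 o1 hp (by omega) (by omega) (by omega) (by omega)
        (by omega) (by omega) (by omega) (by omega)
    · obtain ⟨o1, e2, o2, e3, c1, c2, c3, c4, c5, c6, c7⟩ :=
        core (p 4) (p 1) (p 0) (p 3) (p 2) (p 5) u v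
      exact mkMove p e2 o1 e3 o2 (p 4) (p 5) hp (by omega) (by omega) (by omega) (by omega)
        (by omega) (by omega) (by omega) (by omega)
    · obtain ⟨o1, e2, o2, e3, c1, c2, c3, c4, c5, c6, c7⟩ :=
        core (p 4) (p 1) (p 2) (p 5) (p 0) (p 3) u v
      exact mkMove p e3 o1 e2 (p 3) (p 4) o2 hp (by omega) (by omega) (by omega) (by omega)
        (by omega) (by omega) (by omega) (by omega)
end

section
/- Let n and k be natural numbers with 1 ≤ k ≤ n, and let V = {v₁, v₂, …, v_ℓ} be a nonempty subset of {1, 2, …, n} (identified with vertices of ZMod n) listed in increasing order, with distance set d_i = v_{i+1} − v_i for 1 ≤ i ≤ ℓ−1 and d_ℓ = n + v₁ − v_ℓ. Then V is a circuit of the cycle complex of CN(n,k) if and only if, for every i ∈ {1, …, ℓ} (with indices taken cyclically, so d_{ℓ+1} = d₁): d_i + d_{i+1} > n − k and d_i ≤ n − k. -/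
/-- `V` is a face of the cycle complex of CN(n,k): it is contained in an arc of
`k` consecutive vertices of `ZMod n`. -/
def IsFace (n k : ℕ) (V : Set (ZMod n)) : Prop :=
  ∃ i : ZMod n, V ⊆ {j : ZMod n | ∃ t : ℕ, t < k ∧ j = i + (t : ZMod n)}

/-- `V` is a circuit of the cycle complex of CN(n,k): a minimal non-face. -/
def IsCircuit (n k : ℕ) (V : Set (ZMod n)) : Prop :=
  ¬ IsFace n k V ∧ ∀ W : Set (ZMod n), W ⊂ V → IsFace n k W

lemma face_of_gap (n k : ℕ) (hk1 : 1 ≤ k) (hkn : k ≤ n) (W : Set (ZMod n)) (p : ZMod n)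
    (h : ∀ t : ℕ, 0 < t → t ≤ n - k → p + (t : ZMod n) ∉ W) : IsFace n k W := by
  have : NeZero n := ⟨by omega⟩
  refine ⟨p + ((n - k + 1 : ℕ) : ZMod n), fun j hj => ?_⟩
  set s := (j - (p + ((n - k + 1 : ℕ) : ZMod n))).val with hs
  have hsc : (s : ZMod n) = j - (p + ((n - k + 1 : ℕ) : ZMod n)) := by
    rw [hs, ZMod.natCast_zmod_val]
  have hsn : s < n := ZMod.val_lt _
  refine ⟨s, ?_, by rw [hsc]; ring⟩
  by_contra hlt
  push Not at hlt
  refine h (s + 1 - k) (by omega) (by omega) ?_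
  have e : s + 1 - k + n = s + (n - k + 1) := by omega
  have e2 : ((s + 1 - k : ℕ) : ZMod n) = (s : ZMod n) + ((n - k + 1 : ℕ) : ZMod n) := by
    have := congrArg (fun x : ℕ => (x : ZMod n)) e
    rw [← Nat.cast_add, ← e]
    simp
  rw [e2, hsc]
  convert hj using 1
  ring

lemma gap_of_face (n k : ℕ) (hk1 : 1 ≤ k) (hkn : k ≤ n) (W : Set (ZMod n)) (hW : W.Nonempty)
    (hf : IsFace n k W) :
    ∃ p ∈ W, ∀ t : ℕ, 0 < t → t ≤ n - k → p + (t : ZMod n) ∉ W := by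
  classical
  have : NeZero n := ⟨by omega⟩
  obtain ⟨i, hi⟩ := hf
  have hex : ∃ s : ℕ, i + ((k : ℕ) : ZMod n) - 1 - (s : ZMod n) ∈ W := by
    obtain ⟨w, hw⟩ := hW
    refine ⟨(i + ((k : ℕ) : ZMod n) - 1 - w).val, ?_⟩
    rw [ZMod.natCast_zmod_val]
    convert hw using 1
    ring
  refine ⟨_, Nat.find_spec hex, fun t ht0 ht hmem => ?_⟩
  by_cases hts : t ≤ Nat.find hex
  · refine Nat.find_min hex (m := Nat.find hex - t) (by omega) ?_
    rw [Nat.cast_sub hts]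
    convert hmem using 1
    ring
  · push Not at hts
    obtain ⟨r, hr, hre⟩ := hi hmem
    have hz : ((k + (t - Nat.find hex) : ℕ) : ZMod n) = ((r + 1 : ℕ) : ZMod n) := by
      push_cast [Nat.cast_sub hts.le]
      linear_combination hre
    rw [ZMod.natCast_eq_natCast_iff] at hz
    have hd := (Nat.modEq_iff_dvd' (by omega)).1 hz.symm
    have := Nat.le_of_dvd (by omega) hd
    omega

theorem circuit_iff_distance_conditions (n k : ℕ) (hk1 : 1 ≤ k) (hkn : k ≤ n)
    (ℓ : ℕ) (v : Fin (ℓ + 1) → ℕ) (hmono : StrictMono v)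
    (hlb : ∀ i, 1 ≤ v i) (hub : ∀ i, v i ≤ n)
    (d : Fin (ℓ + 1) → ℕ)
    (hd : ∀ i : Fin (ℓ + 1), d i =
      if h : (i : ℕ) + 1 < ℓ + 1 then v ⟨(i : ℕ) + 1, h⟩ - v i
      else n + v 0 - v i) :
    IsCircuit n k (Set.range fun i : Fin (ℓ + 1) => (v i : ZMod n)) ↔
      ∀ i : Fin (ℓ + 1), n - k < d i + d (i + 1) ∧ d i ≤ n - k := by
  have : NeZero n := ⟨by omega⟩
  set u : Fin (ℓ + 1) → ZMod n := fun i => (v i : ZMod n) with hu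
  have hle : ∀ i j : Fin (ℓ + 1), (i : ℕ) ≤ j → v i ≤ v j := fun i j h => hmono.monotone h
  have hltv : ∀ i j : Fin (ℓ + 1), (i : ℕ) < j → v i < v j := fun i j h => hmono h
  have hinj : Function.Injective u := by
    have key : ∀ i j : Fin (ℓ + 1), u i = u j → v i ≤ v j := by
      intro i j h
      by_contra hlt
      push Not at hlt
      have h' := (ZMod.natCast_eq_natCast_iff _ _ _).1 h
      have hd := (Nat.modEq_iff_dvd' hlt.le).1 h'.symm
      have := Nat.le_of_dvd (by omega) hd
      have := hub i
      have := hlb j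
      omega
    intro i j h
    exact hmono.injective (le_antisymm (key i j h) (key j i h.symm))
  have hpos : ∀ i, 0 < d i := by
    intro i
    rw [hd i]
    split_ifs with h
    · have := hltv i ⟨(i : ℕ) + 1, h⟩ (Nat.lt_succ_self _)
      omega
    · have := hub i
      have := hlb 0
      omega
  have hstep : ∀ i, u i + (d i : ZMod n) = u (i + 1) := by
    intro i
    rw [hd i]
    split_ifs with h
    · have h1 := hltv i ⟨(i : ℕ) + 1, h⟩ (Nat.lt_succ_self _)
      have e : i + 1 = ⟨(i : ℕ) + 1, h⟩ := by
        apply Fin.ext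
        rw [Fin.val_add_one_of_lt']
        exact h
      rw [e]
      simp only [hu]
      rw [Nat.cast_sub h1.le]
      ring
    · have e : i + 1 = 0 := by
        have : i = Fin.last ℓ := by
          apply Fin.ext
          have := i.2
          simp only [Fin.val_last]
          omega
        rw [this, Fin.last_add_one]
      rw [e]
      simp only [hu]
      rw [Nat.cast_sub (by have := hub i; omega)]
      simp
  have hgap : ∀ i, ∀ t : ℕ, 0 < t → t < d i → ∀ j, u i + (t : ZMod n) ≠ u j := by
    intro i t ht0 ht j hj
    have hj' : ((v i + t : ℕ) : ZMod n) = ((v j : ℕ) : ZMod n) := by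
      push_cast
      exact hj
    have hmod := (ZMod.natCast_eq_natCast_iff _ _ _).1 hj'
    rw [hd i] at ht
    have b1 := hub i
    have b2 := hlb i
    have b3 := hub j
    have b4 := hlb j
    have b5 := hle 0 j (Nat.zero_le _)
    split_ifs at ht with h
    · have b6 := hub ⟨(i : ℕ) + 1, h⟩
      have hne : v i + t ≠ v j := by
        intro e
        rcases Nat.lt_or_ge (i : ℕ) j with hij | hij
        · have := hle ⟨(i : ℕ) + 1, h⟩ j hij
          omega
        · have := hle j i hij
          omega
      rcases Nat.lt_or_ge (v i + t) (v j) with hc | hc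
      · have := Nat.le_of_dvd (by omega) ((Nat.modEq_iff_dvd' hc.le).1 hmod)
        omega
      · have := Nat.le_of_dvd (by omega) ((Nat.modEq_iff_dvd' hc).1 hmod.symm)
        omega
    · have b7 := hle j i (by have := j.2; omega)
      have := Nat.le_of_dvd (by omega) ((Nat.modEq_iff_dvd' (by omega)).1 hmod.symm)
      omega
  constructor
  · rintro ⟨hnf, hmin⟩
    have hdle : ∀ i, d i ≤ n - k := by
      intro i
      by_contra hc
      push Not at hc
      refine hnf (face_of_gap n k hk1 hkn _ (u i) ?_)
      rintro t ht0 ht ⟨j, hj⟩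
      exact hgap i t ht0 (by omega) j hj.symm
    intro i
    refine ⟨?_, hdle i⟩
    by_contra hc
    push Not at hc
    have hne1 : i + 1 ≠ i := by
      intro e
      have h1 := hstep i
      rw [e] at h1
      have h2 : ((d i : ℕ) : ZMod n) = 0 := by simpa using h1
      have h3 := Nat.le_of_dvd (hpos i) ((ZMod.natCast_eq_zero_iff _ _).1 h2)
      have := hdle i
      omega
    have hWf := hmin (Set.range u \ {u (i + 1)}) (by
      refine ⟨Set.sdiff_subset, fun hs => ?_⟩
      exact (hs ⟨i + 1, rfl⟩).2 rfl)
    obtain ⟨p, ⟨⟨j, rfl⟩, hpn⟩, hp⟩ := gap_of_face n k hk1 hkn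
      (Set.range u \ {u (i + 1)}) ⟨u i, ⟨i, rfl⟩, fun e => hne1 (hinj e).symm⟩ hWf
    have h1 := hp (d j) (hpos j) (hdle j)
    rw [hstep j] at h1
    have hji : j = i := by
      by_contra hne
      exact h1 ⟨⟨j + 1, rfl⟩, fun e => hne (add_right_cancel (hinj e))⟩
    subst hji
    have h2 := hp (d j + d (j + 1)) (by have := hpos j; omega) hc
    rw [Nat.cast_add, ← add_assoc, hstep j, hstep (j + 1)] at h2
    exact h2 ⟨⟨_, rfl⟩, fun e => hne1 (add_right_cancel (hinj e))⟩
  · intro hcond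
    refine ⟨fun hf => ?_, fun W hW => ?_⟩
    · obtain ⟨p, ⟨j, rfl⟩, hp⟩ := gap_of_face n k hk1 hkn _ (Set.range_nonempty u) hf
      refine hp (d j) (hpos j) (hcond j).2 ⟨j + 1, ?_⟩
      exact (hstep j).symm
    · obtain ⟨x, ⟨m, rfl⟩, hm⟩ := Set.exists_of_ssubset hW
      obtain ⟨i, rfl⟩ : ∃ i, m = i + 1 := ⟨m - 1, by simp⟩
      refine face_of_gap n k hk1 hkn W (u i) fun t ht0 ht hmem => ?_
      obtain ⟨j, hj⟩ := hW.1 hmem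
      have hc := (hcond i).1
      rcases lt_trichotomy t (d i) with h | h | h
      · exact hgap i t ht0 h j hj.symm
      · rw [h, hstep i] at hmem
        exact hm hmem
      · refine hgap (i + 1) (t - d i) (by omega) (by omega) j ?_
        rw [← hstep i, Nat.cast_sub h.le]
        have hj2 : u j = u i + (t : ZMod n) := hj
        rw [hj2]
        ring
end

section
/- Let n and k be natural numbers with n > 1 and 1 < k < n, and set s = n − k. For a natural number ℓ, there exists a circuit V of the cycle complex of CN(n,k) with cardinality ℓ if and only if n ≤ ℓ·s and ℓ·(s+1) ≤ 2n (equivalently, n/s ≤ ℓ ≤ 2n/(s+1)). -/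
lemma aux_cast_inj (n a b : ℕ) (ha : a < n) (hb : b < n) (h : (a : ZMod n) = b) : a = b := by
  rw [ZMod.natCast_eq_natCast_iff', Nat.mod_eq_of_lt ha, Nat.mod_eq_of_lt hb] at h
  exact h

lemma aux_face_iff (n k : ℕ) (hkn : k < n) (V : Set (ZMod n)) :
    IsFace n k V ↔ ∃ i : ZMod n, ∀ t : ℕ, t < n - k → i + (t : ZMod n) ∉ V := by
  have : NeZero n := ⟨by omega⟩
  constructor
  · rintro ⟨i, hi⟩
    refine ⟨i + k, fun t ht hV => ?_⟩
    obtain ⟨t', ht', h⟩ := hi hV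
    have h2 : ((k + t : ℕ) : ZMod n) = (t' : ℕ) := by
      push_cast
      linear_combination h
    have := aux_cast_inj n _ _ (by omega) (by omega) h2
    omega
  · rintro ⟨i, hi⟩
    refine ⟨i + ((n - k : ℕ) : ZMod n), fun j hj => ?_⟩
    set x : ZMod n := j - (i + ((n - k : ℕ) : ZMod n)) with hx
    have hlt := ZMod.val_lt x
    have hxv : ((x.val : ℕ) : ZMod n) = x := ZMod.natCast_zmod_val x
    refine ⟨x.val, ?_, by rw [hxv, hx]; ring⟩
    by_contra hc
    push Not at hc
    apply hi (x.val - k) (by omega)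
    have e : ((x.val - k : ℕ) : ZMod n) = j - i := by
      rw [Nat.cast_sub hc, hxv, hx, Nat.cast_sub hkn.le, ZMod.natCast_self]
      ring
    rw [e]
    simpa using hj

lemma aux_forward (n k : ℕ) (hkn : k < n) (V : Set (ZMod n)) (hV : IsCircuit n k V) :
    n ≤ V.ncard * (n - k) ∧ V.ncard * ((n - k) + 1) ≤ 2 * n := by
  classical
  have : NeZero n := ⟨by omega⟩
  obtain ⟨hnf, hmin⟩ := hV
  rw [aux_face_iff n k hkn] at hnf
  push Not at hnf
  set s := n - k with hs
  have hsn : s ≤ n := by omega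
  set F : Finset (ZMod n) := V.toFinset with hF
  have hFV : ∀ v, v ∈ F ↔ v ∈ V := fun v => by simp [hF]
  have hcard : V.ncard = F.card := by rw [hF, Set.ncard_eq_toFinset_card']
  rw [hcard]
  constructor
  · have hsub : (Finset.univ : Finset (ZMod n)) ⊆
        (F ×ˢ Finset.range s).image (fun p => p.1 - (p.2 : ZMod n)) := by
      intro x _
      obtain ⟨t, ht, hx⟩ := hnf x
      rw [Finset.mem_image]
      exact ⟨(x + t, t), by simp [hFV, hx, ht], by simp⟩
    have := (Finset.card_le_card hsub).trans Finset.card_image_le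
    simpa [ZMod.card] using this
  · have H : ∀ v : ZMod n, ∃ τ : ℕ, v ∈ V → τ < s ∧ ∀ w ∈ V,
        (∀ t : ℕ, t ≤ τ → w = v - t → w = v) ∧ (∀ t : ℕ, t < s - τ → w = v + t → w = v) := by
      intro v
      by_cases hv : v ∈ V
      swap
      · exact ⟨0, fun h => absurd h hv⟩
      have hf := hmin (V \ {v}) ⟨Set.diff_subset, fun h => (h hv).2 rfl⟩
      rw [aux_face_iff n k hkn] at hf
      obtain ⟨i, hi⟩ := hf
      have key : ∀ t < s, i + (t : ZMod n) ∈ V → i + (t : ZMod n) = v := by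
        intro t ht h
        by_contra hne
        exact hi t ht ⟨h, hne⟩
      obtain ⟨τ, hτ, hτV⟩ := hnf i
      have hτv := key τ hτ hτV
      refine ⟨τ, fun _ => ⟨hτ, fun w hw => ⟨fun t ht hwt => ?_, fun t ht hwt => ?_⟩⟩⟩
      · have e : i + ((τ - t : ℕ) : ZMod n) = w := by
          rw [Nat.cast_sub ht, hwt, ← hτv]; ring
        rw [← e]
        exact key _ (by omega) (e ▸ hw)
      · have e : i + ((τ + t : ℕ) : ZMod n) = w := by
          rw [Nat.cast_add, hwt, ← hτv]; ring
        rw [← e]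
        exact key _ (by omega) (e ▸ hw)
    choose τ hτ using H
    have h1 : ∑ v ∈ F, (τ v + 1) ≤ n := by
      have := Finset.card_le_card_of_injOn (s := F.sigma (fun v => Finset.range (τ v + 1)))
        (t := (Finset.univ : Finset (ZMod n)))
        (fun p : (Σ _ : ZMod n, ℕ) => p.1 - (p.2 : ZMod n)) (fun _ _ => Finset.mem_coe.2 (Finset.mem_univ _)) ?_
      · simpa [ZMod.card] using this
      rintro ⟨v, t⟩ hvt ⟨w, t'⟩ hwt h
      simp only [Finset.coe_sigma, Set.mem_sigma_iff, Finset.mem_coe, Finset.mem_range, hFV] at hvt hwt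
      simp only at h
      have hvw : v = w := by
        rcases le_total t t' with hle | hle
        · refine ((hτ w hwt.1).2 v hvt.1).1 (t' - t) (by omega) ?_
          rw [Nat.cast_sub hle]; linear_combination h
        · refine (((hτ v hvt.1).2 w hwt.1).1 (t - t') (by omega) ?_).symm
          rw [Nat.cast_sub hle]; linear_combination -h
      subst hvw
      have a1 := (hτ v hvt.1).1
      have := aux_cast_inj n t t' (by omega) (by omega) (by linear_combination -h)
      rw [this]
    have h2 : ∑ v ∈ F, (s - τ v) ≤ n := by
      have := Finset.card_le_card_of_injOn (s := F.sigma (fun v => Finset.range (s - τ v)))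
        (t := (Finset.univ : Finset (ZMod n)))
        (fun p : (Σ _ : ZMod n, ℕ) => p.1 + (p.2 : ZMod n)) (fun _ _ => Finset.mem_coe.2 (Finset.mem_univ _)) ?_
      · simpa [ZMod.card] using this
      rintro ⟨v, t⟩ hvt ⟨w, t'⟩ hwt h
      simp only [Finset.coe_sigma, Set.mem_sigma_iff, Finset.mem_coe, Finset.mem_range, hFV] at hvt hwt
      simp only at h
      have hvw : v = w := by
        rcases le_total t t' with hle | hle
        · refine ((hτ w hwt.1).2 v hvt.1).2 (t' - t) (by omega) ?_
          rw [Nat.cast_sub hle]; linear_combination h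
        · refine (((hτ v hvt.1).2 w hwt.1).2 (t - t') (by omega) ?_).symm
          rw [Nat.cast_sub hle]; linear_combination -h
      subst hvw
      have := aux_cast_inj n t t' (by omega) (by omega) (by linear_combination h)
      rw [this]
    have h3 : ∑ v ∈ F, (τ v + 1) + ∑ v ∈ F, (s - τ v) = F.card * (s + 1) := by
      rw [← Finset.sum_add_distrib, Finset.sum_const_nat]
      intro v hv
      have := (hτ v ((hFV v).1 hv)).1
      omega
    omega

lemma aux_backward (n k : ℕ) (hkn : k < n) (ℓ : ℕ) (h1 : n ≤ ℓ * (n - k))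
    (h2 : ℓ * ((n - k) + 1) ≤ 2 * n) : ∃ V : Set (ZMod n), IsCircuit n k V ∧ V.ncard = ℓ := by
  classical
  have : NeZero n := ⟨by omega⟩
  have hs1 : 1 ≤ n - k := by omega
  generalize hs : n - k = s at h1 h2 hs1
  have hl : 0 < ℓ := by
    rcases Nat.eq_zero_or_pos ℓ with h | h
    · subst h; omega
    · exact h
  have hln : ℓ ≤ n := by nlinarith
  have hlZ : (0 : ℤ) < ℓ := by exact_mod_cast hl
  have hnZ : (0 : ℤ) < n := by omega
  have h1Z : (n : ℤ) ≤ ℓ * s := by exact_mod_cast h1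
  have h2Z : (ℓ : ℤ) * (s + 1) ≤ 2 * n := by exact_mod_cast h2
  have hlnZ : (ℓ : ℤ) ≤ n := by exact_mod_cast hln
  let f : ℤ → ℤ := fun i => i * n / ℓ
  have flo : ∀ i, f i * ℓ ≤ i * n := fun i => Int.ediv_mul_le _ hlZ.ne'
  have fhi : ∀ i, i * n < (f i + 1) * ℓ := fun i => Int.lt_ediv_add_one_mul_self _ hlZ
  have le_f : ∀ i x : ℤ, x * ℓ ≤ i * n → x ≤ f i := fun i x h => (Int.le_ediv_iff_mul_le hlZ).2 h
  have fshift : ∀ i m, f (i + m * ℓ) = f i + m * n := by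
    intro i m
    show (i + m * ℓ) * n / ℓ = i * n / ℓ + m * n
    rw [← Int.add_mul_ediv_right _ _ hlZ.ne']
    congr 1; ring
  have fmono : StrictMono f := by
    refine strictMono_int_of_lt_succ fun i => ?_
    have : f i + 1 ≤ f (i + 1) := le_f _ _ (by nlinarith [flo i])
    omega
  have fstep : ∀ i, f (i + 1) ≤ f i + s := by
    intro i
    have a := flo (i + 1)
    have b := fhi i
    have : f (i + 1) * ℓ < (f i + s + 1) * ℓ := by nlinarith
    have := lt_of_mul_lt_mul_right this hlZ.le
    omega
  have fstep2 : ∀ i, f i + s + 1 ≤ f (i + 2) := by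
    intro i
    apply le_f
    nlinarith [flo i]
  refine ⟨Set.range (fun i : ℤ => ((f i : ℤ) : ZMod n)), ⟨?_, ?_⟩, ?_⟩
  · rw [aux_face_iff n k hkn, hs]
    push Not
    intro x
    obtain ⟨X, rfl⟩ := ZMod.intCast_surjective x
    -- least i with X ≤ f i
    have hex : ∃ i, X ≤ f i ∧ f (i - 1) < X := by
      refine ⟨(X * ℓ - 1) / n + 1, ?_, ?_⟩
      · apply le_f
        have := Int.lt_ediv_add_one_mul_self (X * ℓ - 1) hnZ
        omega
      · have a := Int.ediv_mul_le (X * ℓ - 1) hnZ.ne'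
        have b := flo ((X * ℓ - 1) / n)
        rw [add_sub_cancel_right]
        refine lt_of_mul_lt_mul_right (?_ : _ * (ℓ : ℤ) < X * ℓ) hlZ.le
        omega
    obtain ⟨i, hi1, hi2⟩ := hex
    have := fstep (i - 1)
    rw [sub_add_cancel] at this
    refine ⟨(f i - X).toNat, by omega, i, ?_⟩
    have e : (((f i - X).toNat : ℕ) : ZMod n) = ((f i - X : ℤ) : ZMod n) := by
      rw [← Int.cast_natCast, Int.toNat_of_nonneg (by omega)]
    simp only [e]
    push_cast; ring
  · intro W hW
    obtain ⟨hsub, hne⟩ := hW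
    obtain ⟨v, ⟨i, rfl⟩, hiW⟩ := Set.not_subset.1 hne
    rw [aux_face_iff n k hkn, hs]
    refine ⟨((f (i - 1) + 1 : ℤ) : ZMod n), fun t ht hmem => ?_⟩
    obtain ⟨j, hj⟩ := hsub hmem
    have hj' : ((f j : ℤ) : ZMod n) = ((f (i - 1) + 1 + t : ℤ) : ZMod n) := by
      rw [show ((f j : ℤ) : ZMod n) = _ from hj]; push_cast; ring
    obtain ⟨m, hm⟩ := (ZMod.intCast_eq_intCast_iff_dvd_sub _ _ n).1 hj'
    have e : f (j + m * ℓ) = f (i - 1) + 1 + t := by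
      rw [fshift]; linear_combination -hm
    have c1 : i - 1 < j + m * ℓ := fmono.lt_iff_lt.1 (by omega)
    have c2 : j + m * ℓ < i - 1 + 2 := fmono.lt_iff_lt.1 (by have := fstep2 (i - 1); omega)
    have c3 : j + m * ℓ = i := by omega
    rw [c3] at e
    apply hiW
    show ((f i : ℤ) : ZMod n) ∈ W
    rw [e]
    convert hmem using 1
    push_cast; ring
  · have himg : Set.range (fun i : ℤ => ((f i : ℤ) : ZMod n)) =
        ((Finset.Ico (0 : ℤ) ℓ).image (fun i : ℤ => ((f i : ℤ) : ZMod n)) : Finset (ZMod n)) := by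
      ext x
      simp only [Set.mem_range, Finset.coe_image, Set.mem_image, Finset.mem_coe, Finset.mem_Ico]
      constructor
      · rintro ⟨i, rfl⟩
        refine ⟨i % ℓ, ⟨Int.emod_nonneg _ hlZ.ne', Int.emod_lt_of_pos _ hlZ⟩, ?_⟩
        have := fshift (i % ℓ) (i / ℓ)
        rw [show i % ℓ + i / ℓ * ℓ = i by rw [mul_comm]; exact Int.emod_add_mul_ediv i ℓ] at this
        rw [this]; push_cast; simp
      · rintro ⟨i, _, rfl⟩
        exact ⟨i, rfl⟩
    rw [himg, Set.ncard_coe_finset, Finset.card_image_of_injOn]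
    · simp
    · intro a ha b hb hab
      simp only [Finset.coe_Ico, Set.mem_Ico] at ha hb
      obtain ⟨m, hm⟩ := (ZMod.intCast_eq_intCast_iff_dvd_sub _ _ n).1 hab
      have e : f (a + m * ℓ) = f b := by rw [fshift]; linear_combination -hm
      have e2 := fmono.injective e
      have : m = 0 := by
        rcases lt_trichotomy m 0 with h | h | h
        · nlinarith
        · exact h
        · nlinarith
      subst this
      simpa using e2

theorem circuit_size_iff (n k : ℕ) (hn : 1 < n) (hk1 : 1 < k) (hkn : k < n)
    (ℓ : ℕ) :
    (∃ V : Set (ZMod n), IsCircuit n k V ∧ V.ncard = ℓ) ↔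
      (n ≤ ℓ * (n - k) ∧ ℓ * ((n - k) + 1) ≤ 2 * n) := by
  constructor
  · rintro ⟨V, hV, rfl⟩
    exact aux_forward n k hkn V hV
  · rintro ⟨h1, h2⟩
    exact aux_backward n k hkn ℓ h1 h2
end

section
/- (First double floor lemma) Let s and n be natural numbers with 0 < s ≤ n, and write n = a·s + b with a = ⌊n/s⌋ and 0 ≤ b < s. Then ⌊n / ⌊n/s⌋⌋ = s if and only if b < a; and if b ≥ a then ⌊n / ⌊n/s⌋⌋ > s. (Here ⌊·/·⌋ is floor division of natural numbers; note a ≥ 1 since s ≤ n.) -/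
theorem first_double_floor (s n : ℕ) (hs : 0 < s) (hsn : s ≤ n)
    (a b : ℕ) (ha : a = n / s) (hb : b = n % s) :
    (n / (n / s) = s ↔ b < a) ∧ (a ≤ b → s < n / (n / s)) := by
  have hpos : 0 < a := ha ▸ Nat.div_pos hsn hs
  have hn : n = b + a * s := by
    rw [ha, hb, Nat.mul_comm]
    exact (Nat.mod_add_div n s).symm
  have key : n / a = b / a + s := by
    rw [hn]
    exact Nat.add_mul_div_left b s hpos
  rw [← ha, key]
  have h0 : b / a = 0 ↔ b < a := by
    rw [Nat.div_eq_zero_iff]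
    omega
  refine ⟨by rw [← h0]; omega, fun h => ?_⟩
  have := Nat.div_pos h hpos
  omega
end

section
/- (Second double floor lemma) Let m and n be natural numbers with m < n, and let f be a real number with 0 ≤ f < 1 and m + f > 0. Set ℓ = ⌊n / (m + f)⌋ (the floor of the real number n/(m+f), a natural number, which is positive), and write n = a·ℓ + b with a = ⌊n/ℓ⌋ and 0 ≤ b < ℓ. If m = ⌊n/ℓ⌋, then b/ℓ ≥ f, i.e., (b : ℝ) ≥ f·ℓ. -/
theorem second_double_floor (m n : ℕ) (hmn : m < n) (f : ℝ)
    (hf0 : 0 ≤ f) (hf1 : f < 1) (hmf : 0 < (m : ℝ) + f)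
    (ℓ b : ℕ) (hℓ : ℓ = ⌊(n : ℝ) / ((m : ℝ) + f)⌋₊)
    (hb : b = n % ℓ) (hm : m = n / ℓ) :
    f * (ℓ : ℝ) ≤ (b : ℝ) := by
  have h1 : (ℓ : ℝ) ≤ (n : ℝ) / ((m : ℝ) + f) := by
    rw [hℓ]
    exact Nat.floor_le (by positivity)
  rw [le_div_iff₀ hmf] at h1
  have h2 : ℓ * m + b = n := by
    rw [hb, hm]
    exact Nat.div_add_mod n ℓ
  have h3 : (ℓ : ℝ) * m + b = n := by exact_mod_cast h2
  nlinarith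
end
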